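/- Let A and B be commutative rings, f : A → B a ring homomorphism, and J an ideal of B. Assume that height 𝒫 ≤ height 𝒫^c for every prime ideal 𝒫 of A⋈^f J, where 𝒫^c is the contraction of 𝒫 to A along ι_A. If A is Cohen-Macaulay in the sense of ideals and kgr_A(𝔞, J) ≥ height 𝔞 for every ideal 𝔞 of A, then A⋈^f J is Cohen-Macaulay in the sense of ideals. -/

import Mathlib

/-- The Koszul cochain differential of the complex `Hom(K_•(x), M)`, described explicitly:
the degree-`i` term is the module of `M`-valued functions on the `i`-element subsets of
`Fin n`, and the differential is the usual alternating-sum formula. -/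
noncomputable def koszulMap (A : Type*) [CommRing A] (M : Type*) [AddCommGroup M]
    [Module A M] {n : ℕ} (x : Fin n → A) (i : ℕ) :
    ({s : Finset (Fin n) // s.card = i} → M) →ₗ[A]
      ({s : Finset (Fin n) // s.card = i + 1} → M) where
  toFun g t := ∑ j ∈ t.1.attach,
    (((-1 : A) ^ ((t.1.filter (fun k => k < j.1)).card)) * x j.1) •
      g ⟨t.1.erase j.1, by
        rw [Finset.card_erase_of_mem j.2, t.2]; omega⟩

  map_add' g h := funext fun t => by
    simp [smul_add, Finset.sum_add_distrib]
  map_smul' a g := funext fun t => by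
    simp only [Pi.smul_apply, RingHom.id_apply, Finset.smul_sum]
    exact Finset.sum_congr rfl fun j _ => by
      rw [smul_smul, smul_smul, mul_comm]

/-- Nonvanishing of the `i`-th cohomology `H^i(Hom(K_•(x), M))` of the Koszul
cochain complex. -/
def koszulCohomologyNeZero (A : Type*) [CommRing A] (M : Type*) [AddCommGroup M]
    [Module A M] {n : ℕ} (x : Fin n → A) : ℕ → Prop
  | 0 => LinearMap.ker (koszulMap A M x 0) ≠ ⊥
  | (i + 1) => ¬ (LinearMap.ker (koszulMap A M x (i + 1)) ≤
      LinearMap.range (koszulMap A M x i))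

/-- The Koszul grade of a finite sequence `x` on `M`:
`inf { i : H^i(Hom(K_•(x), M)) ≠ 0 }` (an element of `ℕ∞`, equal to `⊤` if all
cohomology vanishes). -/
noncomputable def kgrSeq (A : Type*) [CommRing A] (M : Type*) [AddCommGroup M]
    [Module A M] {n : ℕ} (x : Fin n → A) : ℕ∞ :=
  sInf {i : ℕ∞ | ∃ k : ℕ, i = k ∧ koszulCohomologyNeZero A M x k}

/-- The Koszul grade `kgr_A(𝔞, M)` of an arbitrary ideal `𝔞` on `M`: the supremum of the
Koszul grades of finite sequences contained in `𝔞` (equivalently, of the finitely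
generated subideals of `𝔞`). -/
noncomputable def kgr (A : Type*) [CommRing A] (𝔞 : Ideal A) (M : Type*)
    [AddCommGroup M] [Module A M] : ℕ∞ :=
  ⨆ (n : ℕ) (x : Fin n → A) (_ : ∀ j, x j ∈ 𝔞), kgrSeq A M x

/-- The height of an ideal: the infimum of the heights of the primes containing it. -/
noncomputable def idealHeight (A : Type*) [CommRing A] (𝔞 : Ideal A) : ℕ∞ :=
  ⨅ (p : PrimeSpectrum A) (_ : 𝔞 ≤ p.asIdeal), Order.height p

/-- A commutative ring `R` is Cohen-Macaulay in the sense of a class `𝒜` of ideals if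
`height 𝔞 = kgr_R(𝔞, R)` for every `𝔞 ∈ 𝒜`. -/
def IsCMSense (R : Type*) [CommRing R] (𝒜 : Set (Ideal R)) : Prop :=
  ∀ 𝔞 ∈ 𝒜, idealHeight R 𝔞 = kgr R 𝔞 R

/-- Cohen-Macaulay in the sense of ideals. -/
def IsCMIdeals (R : Type*) [CommRing R] : Prop :=
  ∀ 𝔞 : Ideal R, idealHeight R 𝔞 = kgr R 𝔞 R

/-- Cohen-Macaulay in the sense of maximal ideals. -/
def IsCMMaximal (R : Type*) [CommRing R] : Prop :=
  ∀ 𝔪 : Ideal R, 𝔪.IsMaximal → idealHeight R 𝔪 = kgr R 𝔪 R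

/-- The amalgamation `A ⋈^f J = {(a, f a + j) : a ∈ A, j ∈ J}` of `A` with `B` along the
ideal `J` of `B` with respect to `f : A →+* B`, as a subring of `A × B`. -/
def amalgamation {A B : Type*} [CommRing A] [CommRing B] (f : A →+* B) (J : Ideal B) :
    Subring (A × B) where
  carrier := {p | p.2 - f p.1 ∈ J}
  zero_mem' := by simp
  one_mem' := by simp
  add_mem' := fun {p q} hp hq => by
    have := J.add_mem hp hq
    simpa [add_sub_add_comm] using this
  neg_mem' := fun {p} hp => by
    show (-p).2 - f ((-p).1) ∈ J
    have key : (-p).2 - f ((-p).1) = -(p.2 - f p.1) := by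
      simp only [Prod.fst_neg, Prod.snd_neg, map_neg]; ring
    rw [key]
    exact J.neg_mem hp
  mul_mem' := fun {p q} hp hq => by
    show (p * q).2 - f ((p * q).1) ∈ J
    have key : (p * q).2 - f ((p * q).1)
        = p.2 * (q.2 - f q.1) + (p.2 - f p.1) * f q.1 := by
      simp only [Prod.fst_mul, Prod.snd_mul, map_mul]; ring
    rw [key]
    exact J.add_mem (J.mul_mem_left _ hq) (J.mul_mem_right _ hp)

/-- The natural embedding `ι_A : A → A ⋈^f J`, `a ↦ (a, f a)`. -/
def amalgIota {A B : Type*} [CommRing A] [CommRing B] (f : A →+* B) (J : Ideal B) :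
    A →+* amalgamation f J where
  toFun a := ⟨(a, f a), show (a, f a).2 - f (a, f a).1 ∈ J by simp⟩
  map_one' := Subtype.ext (by simp)
  map_mul' a b := Subtype.ext (by simp)
  map_zero' := Subtype.ext (by simp)
  map_add' a b := Subtype.ext (by simp)

/-- The extension `𝔞^e = 𝔞(A ⋈^f J)` of an ideal `𝔞` of `A` along `ι_A`. -/
noncomputable def idealExt {A B : Type*} [CommRing A] [CommRing B] (f : A →+* B)
    (J : Ideal B) (𝔞 : Ideal A) : Ideal ↥(amalgamation f J) :=
  Ideal.map (amalgIota f J) 𝔞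

/-- `kgr_A(𝔞, J)` where the ideal `J` of `B` is viewed as an `A`-module via `f`. -/
noncomputable def kgrIdeal {A B : Type*} [CommRing A] [CommRing B] (f : A →+* B)
    (J : Ideal B) (𝔞 : Ideal A) : ℕ∞ :=
  letI : Module A J := Module.compHom J f
  kgr A 𝔞 J

/-- The ideal `𝔭'^f = 𝔭 ⋈^f J = {(p, f p + j) : p ∈ 𝔭, j ∈ J}` of `A ⋈^f J`. -/
def primeAmalg {A B : Type*} [CommRing A] [CommRing B] (f : A →+* B) (J : Ideal B)
    (𝔭 : Ideal A) : Ideal ↥(amalgamation f J) where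
  carrier := {z | (z : A × B).1 ∈ 𝔭}
  zero_mem' := by simp
  add_mem' := fun {a b} ha hb => 𝔭.add_mem ha hb
  smul_mem' := fun c {z} hz => 𝔭.mul_mem_left (c : A × B).1 hz

/-- The ideal `𝔮̄^f = {(a, f a + j) : a ∈ A, j ∈ J, f a + j ∈ 𝔮}` of `A ⋈^f J`. -/
def qbarAmalg {A B : Type*} [CommRing A] [CommRing B] (f : A →+* B) (J : Ideal B)
    (𝔮 : Ideal B) : Ideal ↥(amalgamation f J) where
  carrier := {z | (z : A × B).2 ∈ 𝔮}
  zero_mem' := by simp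
  add_mem' := fun {a b} ha hb => 𝔮.add_mem ha hb
  smul_mem' := fun c {z} hz => 𝔮.mul_mem_left (c : A × B).2 hz

/-- A ring homomorphism `f : A →+* B` satisfies the going-down property. -/
def RingHom.GoesDown {A B : Type*} [CommRing A] [CommRing B] (f : A →+* B) : Prop :=
  ∀ (𝔭' 𝔭 : Ideal A), 𝔭'.IsPrime → 𝔭.IsPrime → 𝔭' ≤ 𝔭 →
    ∀ 𝔮 : Ideal B, 𝔮.IsPrime → 𝔮.comap f = 𝔭 →
      ∃ 𝔮' : Ideal B, 𝔮'.IsPrime ∧ 𝔮' ≤ 𝔮 ∧ 𝔮'.comap f = 𝔭'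

section KoszulDifferential

open Finset

variable {A : Type*} [CommRing A] {ι : Type*} [LinearOrder ι]

/-- The sign `(-1) ^ #{k ∈ t | k < p}`. -/
def koszulSign (A : Type*) [CommRing A] (p : ι) (t : Finset ι) : A :=
  (-1) ^ #{k ∈ t | k < p}

lemma koszulSign_mul_self (p : ι) (t : Finset ι) :
    koszulSign A p t * koszulSign A p t = 1 := by
  rw [koszulSign, ← mul_pow]; simp

lemma koszulSign_insert {p q : ι} {t : Finset ι} (hp : p ∉ t) :
    koszulSign A q (insert p t) = (if p < q then -1 else 1) * koszulSign A q t := by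
  unfold koszulSign
  rw [filter_insert]
  split_ifs with h
  · rw [card_insert_of_notMem (by simp [hp]), pow_succ]; ring
  · simp

variable {M : Type*} [AddCommGroup M] [Module A M]

/-- The Koszul differential on functions of arbitrary finite subsets of the index type; its
restriction to subsets of cardinality `i` is the differential of degree `i`. -/
def koszulDiff (x : ι → A) : (Finset ι → M) →ₗ[A] (Finset ι → M) where
  toFun g t := ∑ j ∈ t, (koszulSign A j t * x j) • g (t.erase j)
  map_add' g h := funext fun t => by simp [smul_add, sum_add_distrib]
  map_smul' a g := funext fun t => by
    simp only [Pi.smul_apply, RingHom.id_apply, smul_sum]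
    exact sum_congr rfl fun j _ => smul_comm ..

lemma koszulDiff_apply (x : ι → A) (g : Finset ι → M) (t : Finset ι) :
    koszulDiff x g t = ∑ j ∈ t, (koszulSign A j t * x j) • g (t.erase j) := rfl

lemma koszulDiff_congr (x : ι → A) {g h : Finset ι → M} {t : Finset ι}
    (H : ∀ u ⊆ t, #u + 1 = #t → g u = h u) : koszulDiff x g t = koszulDiff x h t :=
  sum_congr rfl fun j hj => by rw [H _ (erase_subset j t) (card_erase_add_one hj)]

/-- The Koszul complex of a sequence enlarged by `x p` is a mapping cone. -/
lemma koszulDiff_insert (x : ι → A) (g : Finset ι → M) {p : ι} {t : Finset ι} (hp : p ∉ t) :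
    koszulSign A p t • koszulDiff x g (insert p t) =
      x p • g t - koszulDiff x (fun u => koszulSign A p u • g (insert p u)) t := by
  rw [koszulDiff_apply, koszulDiff_apply, sum_insert hp, smul_add, erase_insert hp,
    koszulSign_insert hp, smul_smul, if_neg (lt_irrefl p), one_mul, ← mul_assoc,
    koszulSign_mul_self, one_mul, sub_eq_add_neg, smul_sum, ← sum_neg_distrib]
  congr 1
  refine sum_congr rfl fun j hj => ?_
  have hjp : p ≠ j := fun h => hp (h ▸ hj)
  rw [erase_insert_of_ne hjp, smul_smul, smul_smul, ← neg_smul, koszulSign_insert hp]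
  have h := koszulSign_insert (A := A) (q := p) (notMem_erase j t)
  rw [insert_erase hj] at h
  rw [h]
  congr 1
  rcases lt_or_gt_of_ne hjp with h1 | h1
  · rw [if_neg h1.not_gt, if_pos h1]; ring
  · rw [if_neg h1.not_gt, if_pos h1]; ring

lemma koszulSign_smul_cancel {p : ι} {t : Finset ι} {m m' : M}
    (h : koszulSign A p t • m = koszulSign A p t • m') : m = m' := by
  simpa [smul_smul, koszulSign_mul_self] using congrArg (koszulSign A p t • ·) h

lemma koszulDiff_koszulDiff (x : ι → A) (g : Finset ι → M) (t : Finset ι) :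
    koszulDiff x (koszulDiff x g) t = 0 := by
  induction t using Finset.induction_on generalizing g with
  | empty => simp [koszulDiff_apply]
  | insert p t hp ih =>
    apply koszulSign_smul_cancel (A := A) (p := p) (t := t)
    rw [koszulDiff_insert x _ hp, koszulDiff_congr x
      (h := x p • g - koszulDiff x (fun u => koszulSign A p u • g (insert p u)))
      fun u hu _ => koszulDiff_insert x g fun h => hp (hu h)]
    rw [map_sub, map_smul, Pi.sub_apply, ih]
    simp

/-- The cochain on `insert p T` with components `a` and `b` in the mapping cone description. -/
def koszulGlue (A : Type*) [CommRing A] [Module A M] (p : ι) (a b : Finset ι → M) :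
    Finset ι → M := fun u =>
  if p ∈ u then koszulSign A p (u.erase p) • b (u.erase p) else a u

lemma koszulGlue_of_notMem {p : ι} (a b : Finset ι → M) {u : Finset ι} (hp : p ∉ u) :
    koszulGlue A p a b u = a u := if_neg hp

lemma koszulDiff_koszulGlue_of_notMem (x : ι → A) {p : ι} (a b : Finset ι → M) {t : Finset ι}
    (hp : p ∉ t) : koszulDiff x (koszulGlue A p a b) t = koszulDiff x a t :=
  koszulDiff_congr x fun _ hu _ => koszulGlue_of_notMem a b fun h => hp (hu h)

lemma koszulDiff_koszulGlue_insert (x : ι → A) {p : ι} (a b : Finset ι → M) {t : Finset ι}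
    (hp : p ∉ t) : koszulSign A p t • koszulDiff x (koszulGlue A p a b) (insert p t) =
      x p • a t - koszulDiff x b t := by
  rw [koszulDiff_insert x _ hp, koszulGlue_of_notMem a b hp]
  congr 1
  refine koszulDiff_congr x fun u hu _ => ?_
  have hpu : p ∉ u := fun h => hp (hu h)
  simp [koszulGlue, erase_insert hpu, smul_smul, koszulSign_mul_self]

lemma subset_insert_cases {p : ι} {t T : Finset ι} (h : t ⊆ insert p T) :
    (p ∉ t ∧ t ⊆ T) ∨ ∃ u ⊆ T, p ∉ u ∧ t = insert p u := by
  by_cases hp : p ∈ t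
  · exact Or.inr ⟨t.erase p, subset_insert_iff.mp h, notMem_erase p t, (insert_erase hp).symm⟩
  · exact Or.inl ⟨hp, (subset_insert_iff_of_notMem hp).mp h⟩

/-- Every class in the `i`-th Koszul cohomology of `(x j)_{j ∈ T}` on `M` is annihilated by an
element of `S`. -/
def KoszulVanish (S : Submonoid A) (M : Type*) [AddCommGroup M] [Module A M] (x : ι → A)
    (T : Finset ι) (i : ℕ) : Prop :=
  ∀ g : Finset ι → M, (∀ t ⊆ T, #t = i + 1 → koszulDiff x g t = 0) →
    ∃ s ∈ S, ∃ h : Finset ι → M, ∀ t ⊆ T, #t = i → s • g t = koszulDiff x h t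

variable {S : Submonoid A} {x : ι → A} {T : Finset ι}

lemma KoszulVanish.insert_zero {p : ι} (H : KoszulVanish S M x T 0) :
    KoszulVanish S M x (insert p T) 0 := by
  intro g hg
  obtain ⟨s, hs, h, hh⟩ := H g fun t ht => hg t (ht.trans (subset_insert p T))
  refine ⟨s, hs, h, fun t _ ht0 => hh t ?_ ht0⟩
  rw [card_eq_zero.mp ht0]
  exact empty_subset T

lemma KoszulVanish.insert_succ {p : ι} (hp : p ∉ T) {i : ℕ} (H : KoszulVanish S M x T i)
    (H' : KoszulVanish S M x T (i + 1)) : KoszulVanish S M x (insert p T) (i + 1) := by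
  intro g hg
  obtain ⟨s, hs, h, hh⟩ := H' g fun t ht => hg t (ht.trans (subset_insert p T))
  set g' := s • g - koszulDiff x h with hg'
  have hg0 : ∀ t ⊆ T, #t = i + 1 → g' t = 0 := fun t ht hti => by
    simp [hg', hh t ht hti]
  have hgc : ∀ t ⊆ insert p T, #t = i + 1 + 1 → koszulDiff x g' t = 0 := fun t ht hti => by
    simp [hg', hg t ht hti, koszulDiff_koszulDiff]
  obtain ⟨s', hs', h', hh'⟩ := H (fun u => koszulSign A p u • g' (insert p u))
    fun t ht hti => by
      have hpt : p ∉ t := fun h => hp (ht h)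
      have := koszulDiff_insert x g' hpt
      rw [hgc _ (insert_subset_insert p ht) (by rw [card_insert_of_notMem hpt, hti]),
        hg0 t ht hti] at this
      simpa using this
  refine ⟨s' * s, S.mul_mem hs' hs, s' • h + koszulGlue A p 0 (-h'), fun t ht hti => ?_⟩
  have hsg : (s' * s) • g t = s' • koszulDiff x h t + s' • g' t := by
    simp [hg', smul_sub, smul_smul]
  rw [hsg, map_add, map_smul, Pi.add_apply, Pi.smul_apply]
  congr 1
  rcases subset_insert_cases ht with ⟨hpt, htT⟩ | ⟨u, huT, hpu, rfl⟩
  · rw [hg0 t htT hti, koszulDiff_koszulGlue_of_notMem x _ _ hpt]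
    simp
  · apply koszulSign_smul_cancel (A := A) (p := p) (t := u)
    rw [koszulDiff_koszulGlue_insert x _ _ hpu]
    rw [card_insert_of_notMem hpu, add_left_inj] at hti
    have := hh' u huT hti
    rw [smul_comm] at this
    simp [this]

lemma KoszulVanish.mono {r : ℕ} {T' : Finset ι} (hT : T ⊆ T')
    (H : ∀ i < r, KoszulVanish S M x T i) : ∀ i < r, KoszulVanish S M x T' i := by
  rw [← union_eq_right.mpr hT, union_comm]
  clear hT
  induction T' using Finset.induction_on with
  | empty => simpa using H
  | insert p T' _ ih =>
    rw [insert_union]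
    by_cases hp : p ∈ T' ∪ T
    · rwa [insert_eq_of_mem hp]
    · rintro (_ | i) hi
      · exact (ih 0 hi).insert_zero
      · exact (ih i (by omega)).insert_succ hp (ih _ hi)

/-- The Koszul cohomology is annihilated by the ideal generated by the sequence. -/
lemma exists_koszulDiff_eq_smul {i : ℕ} {c : Finset ι → M}
    (hc : ∀ t ⊆ T, #t = i + 1 → koszulDiff x c t = 0) {a : A} (ha : a ∈ Ideal.span (x '' T)) :
    ∃ b : Finset ι → M, ∀ t ⊆ T, #t = i → a • c t = koszulDiff x b t := by
  induction ha using Submodule.span_induction with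
  | zero => exact ⟨0, by simp⟩
  | add a a' _ _ h h' =>
    obtain ⟨b, hb⟩ := h
    obtain ⟨b', hb'⟩ := h'
    exact ⟨b + b', fun t ht hti => by simp [add_smul, hb t ht hti, hb' t ht hti]⟩
  | smul r a _ h =>
    obtain ⟨b, hb⟩ := h
    exact ⟨r • b, fun t ht hti => by simp [mul_smul, hb t ht hti]⟩
  | mem _ h =>
    obtain ⟨q, hq, rfl⟩ := h
    rw [mem_coe] at hq
    refine ⟨koszulGlue A q (fun u => koszulSign A q u • c (insert q u)) 0, fun t ht hti => ?_⟩
    rw [← insert_erase hq] at ht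
    rcases subset_insert_cases ht with ⟨hqt, htT⟩ | ⟨u, huT, hqu, rfl⟩
    · rw [koszulDiff_koszulGlue_of_notMem x _ _ hqt]
      have := koszulDiff_insert x c hqt
      rw [hc _ (insert_subset hq (htT.trans (erase_subset q T)))
        (by rw [card_insert_of_notMem hqt, hti]), smul_zero] at this
      exact sub_eq_zero.mp this.symm
    · apply koszulSign_smul_cancel (A := A) (p := q) (t := u)
      rw [koszulDiff_koszulGlue_insert x _ _ hqu, smul_comm]
      simp

/-- Vanishing of the cohomology of the enlarged sequence makes `x p` act injectively. -/
lemma KoszulVanish.of_smul {p : ι} (hp : p ∉ T) {i : ℕ}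
    (H : KoszulVanish S M x (insert p T) i) {c : Finset ι → M}
    (hc : ∀ t ⊆ T, #t = i + 1 → koszulDiff x c t = 0)
    (hpc : ∃ s ∈ S, ∃ b : Finset ι → M, ∀ t ⊆ T, #t = i → s • x p • c t = koszulDiff x b t) :
    ∃ s ∈ S, ∃ b : Finset ι → M, ∀ t ⊆ T, #t = i → s • c t = koszulDiff x b t := by
  obtain ⟨s, hs, b, hb⟩ := hpc
  obtain ⟨s', hs', h, hh⟩ := H (koszulGlue A p (s • c) b) fun t ht hti => by
    rcases subset_insert_cases ht with ⟨hpt, htT⟩ | ⟨u, huT, hpu, rfl⟩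
    · rw [koszulDiff_koszulGlue_of_notMem x _ _ hpt]
      simp [hc t htT hti]
    · apply koszulSign_smul_cancel (A := A) (p := p) (t := u)
      rw [koszulDiff_koszulGlue_insert x _ _ hpu, Pi.smul_apply, smul_comm]
      rw [card_insert_of_notMem hpu, add_left_inj] at hti
      simp [hb u huT hti]
  refine ⟨s' * s, S.mul_mem hs' hs, h, fun t ht hti => ?_⟩
  rw [← hh t (ht.trans (subset_insert p T)) hti,
    koszulGlue_of_notMem _ _ fun h => hp (ht h), mul_smul, Pi.smul_apply]

lemma KoszulVanish.of_insert {p : ι} (hp : p ∉ T) {i : ℕ}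
    (H : KoszulVanish S M x (insert p T) i) {s : A} (hs : s ∈ S) {N : ℕ}
    (hN : s * x p ^ N ∈ Ideal.span (x '' T)) : KoszulVanish S M x T i := by
  intro c hc
  have key : ∀ n, ∃ s ∈ S, ∃ b : Finset ι → M,
      ∀ t ⊆ T, #t = i → s • x p ^ (N - n) • c t = koszulDiff x b t := by
    intro n
    induction n with
    | zero =>
      obtain ⟨b, hb⟩ := exists_koszulDiff_eq_smul hc hN
      exact ⟨s, hs, b, fun t ht hti => by simpa [mul_smul] using hb t ht hti⟩
    | succ n ih =>
      by_cases hn : N ≤ n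
      · rwa [Nat.sub_eq_zero_of_le (by omega : N ≤ n + 1), ← Nat.sub_eq_zero_of_le hn]
      · refine H.of_smul hp (c := x p ^ (N - (n + 1)) • c)
          (fun t ht hti => by simp [hc t ht hti]) ?_
        obtain ⟨s, hs, b, hb⟩ := ih
        refine ⟨s, hs, b, fun t ht hti => ?_⟩
        rw [← hb t ht hti, Pi.smul_apply, smul_smul (x p), ← pow_succ',
          show N - (n + 1) + 1 = N - n by omega]
  simpa using key N

lemma KoszulVanish.of_subset {T' : Finset ι} (hT : T ⊆ T') {i : ℕ}
    (hx : ∀ p ∈ T', ∃ s ∈ S, ∃ N, s * x p ^ N ∈ Ideal.span (x '' T))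
    (H : KoszulVanish S M x T' i) : KoszulVanish S M x T i := by
  rw [← union_eq_right.mpr hT, union_comm] at H
  clear hT
  induction T' using Finset.induction_on with
  | empty => simpa using H
  | insert p T' _ ih =>
    refine ih (fun q hq => hx q (mem_insert_of_mem hq)) ?_
    rw [insert_union] at H
    by_cases hp : p ∈ T' ∪ T
    · rwa [insert_eq_of_mem hp] at H
    · obtain ⟨s, hs, N, hN⟩ := hx p (mem_insert_self p T')
      refine H.of_insert hp hs (Ideal.span_mono (Set.image_mono ?_) hN)
      exact_mod_cast subset_union_right

/-- If the top Koszul cohomology on the ring vanishes after localizing at `S`, then the ideal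
generated by the sequence meets `S`. -/
lemma KoszulVanish.exists_mem_span (H : KoszulVanish S A x T #T) :
    ∃ s ∈ S, s ∈ Ideal.span (x '' T) := by
  obtain ⟨s, hs, h, hh⟩ := H (fun _ => 1) fun t ht hti => by
    have := card_le_card ht
    omega
  refine ⟨s, hs, ?_⟩
  have hT := hh T subset_rfl rfl
  rw [smul_eq_mul, mul_one, koszulDiff_apply] at hT
  rw [hT]
  refine Ideal.sum_mem _ fun j hj => ?_
  rw [smul_eq_mul]
  exact Ideal.mul_mem_right _ _ (Ideal.mul_mem_left _ _ (Ideal.subset_span ⟨j, hj, rfl⟩))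

lemma koszulDiff_map {κ : Type*} [LinearOrder κ] (e : ι ↪o κ) (y : κ → A)
    (g : Finset κ → M) (t : Finset ι) :
    koszulDiff y g (t.map e.toEmbedding) =
      koszulDiff (y ∘ e) (fun u => g (u.map e.toEmbedding)) t := by
  rw [koszulDiff_apply, koszulDiff_apply, sum_map]
  refine sum_congr rfl fun j _ => ?_
  rw [← map_erase]
  simp [koszulSign, filter_map]

lemma koszulVanish_map_iff {κ : Type*} [LinearOrder κ] (e : ι ↪o κ) {y : κ → A} {i : ℕ} :
    KoszulVanish S M y (T.map e.toEmbedding) i ↔ KoszulVanish S M (y ∘ e) T i := by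
  have hinj := Finset.map_injective e.toEmbedding
  constructor
  · intro H g hg
    obtain ⟨s, hs, h, hh⟩ := H (Function.extend (Finset.map e.toEmbedding) g 0)
      fun t ht hti => by
        obtain ⟨u, hu, rfl⟩ := subset_map_iff.mp ht
        rw [koszulDiff_map]
        simp only [hinj.extend_apply]
        exact hg u hu (by simpa using hti)
    refine ⟨s, hs, fun u => h (u.map e.toEmbedding), fun t ht hti => ?_⟩
    rw [← koszulDiff_map, ← hh _ (map_subset_map.mpr ht) (by simpa using hti),
      hinj.extend_apply]
  · intro H g hg
    obtain ⟨s, hs, h, hh⟩ := H (fun u => g (u.map e.toEmbedding)) fun t ht hti => by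
      rw [← koszulDiff_map]
      exact hg _ (map_subset_map.mpr ht) (by simpa using hti)
    refine ⟨s, hs, Function.extend (Finset.map e.toEmbedding) h 0, fun t ht hti => ?_⟩
    obtain ⟨u, hu, rfl⟩ := subset_map_iff.mp ht
    rw [koszulDiff_map]
    simp only [hinj.extend_apply]
    exact hh u hu (by simpa using hti)

lemma map_koszulDiff {R N : Type*} [CommRing R] [AddCommGroup N] [Module R N] {y : ι → R}
    (φ : M →+ N) (hφ : ∀ j m, φ (x j • m) = y j • φ m) (g : Finset ι → M) (t : Finset ι) :
    φ (koszulDiff x g t) = koszulDiff y (fun u => φ (g u)) t := by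
  rw [koszulDiff_apply, koszulDiff_apply, map_sum]
  refine sum_congr rfl fun j _ => ?_
  rw [koszulSign, koszulSign]
  rcases neg_one_pow_eq_or ℤ #{k ∈ t | k < j} with h | h
  · have hA := congrArg (Int.cast : ℤ → A) h
    have hR := congrArg (Int.cast : ℤ → R) h
    push_cast at hA hR
    rw [hA, hR, one_mul, one_mul, hφ]
  · have hA := congrArg (Int.cast : ℤ → A) h
    have hR := congrArg (Int.cast : ℤ → R) h
    push_cast at hA hR
    rw [hA, hR, neg_one_mul, neg_one_mul, neg_smul, neg_smul, map_neg, hφ]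

end KoszulDifferential

section LocalKronecker

variable {R : Type*} [CommRing R]

/-- An element lying in all primes between `I` and `P` lies in the radical of `I` after
localizing at `P`. -/
lemma Ideal.exists_mul_pow_mem_of_forall_prime {I P : Ideal R} [P.IsPrime] {z : R}
    (hz : ∀ Q : Ideal R, Q.IsPrime → I ≤ Q → Q ≤ P → z ∈ Q) :
    ∃ s ∉ P, ∃ N, s * z ^ N ∈ I := by
  by_contra! h
  have hdisj : Disjoint (I : Set R) (P.primeCompl ⊔ Submonoid.powers z : Submonoid R) := by
    rw [Set.disjoint_right]
    intro a ha haI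
    obtain ⟨s, hs, _, ⟨N, rfl⟩, rfl⟩ := Submonoid.mem_sup.mp ha
    exact h s hs N haI
  obtain ⟨Q, hQ, hIQ, hd⟩ := Ideal.exists_le_prime_disjoint I _ hdisj
  rw [Set.disjoint_right] at hd
  refine hd ((le_sup_right : _ ≤ P.primeCompl ⊔ Submonoid.powers z)
    (Submonoid.mem_powers z)) (hz Q hQ hIQ fun a ha => ?_)
  by_contra haP
  exact hd ((le_sup_left : _ ≤ P.primeCompl ⊔ Submonoid.powers z) haP) ha

/-- The core step of the local Kronecker theorem: if chains of primes between `I` and `P` have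
length at most `h`, then `z` can be absorbed into any `h` elements of `P`, up to radical. -/
lemma exists_absorb (P : PrimeSpectrum R) (h : ℕ) (I : Ideal R) (hI : I ≤ P.asIdeal)
    (hl : ∀ l : LTSeries (PrimeSpectrum R), I ≤ l.head.asIdeal → l.last ≤ P → l.length ≤ h)
    (x : Fin h → R) (hx : ∀ i, x i ∈ P.asIdeal) {z : R} (hz : z ∈ P.asIdeal) :
    ∃ a : Fin h → R, ∀ Q : Ideal R, Q.IsPrime → I ≤ Q → Q ≤ P.asIdeal →
      (∀ i, x i + z * a i ∈ Q) → z ∈ Q := by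
  induction h generalizing I with
  | zero =>
    refine ⟨0, fun Q hQ hIQ hQP _ => ?_⟩
    rcases hQP.eq_or_lt with rfl | hlt
    · exact hz
    · have hlt' : (⟨Q, hQ⟩ : PrimeSpectrum R) < P := hlt
      obtain ⟨l, hhead, hlast⟩ : ∃ l : LTSeries (PrimeSpectrum R), l.head = P ∧ l.last = P :=
        ⟨RelSeries.singleton _ P, rfl, rfl⟩
      have := hl (l.cons ⟨Q, hQ⟩ (hhead.symm ▸ hlt')) (by simpa using hIQ) (by simp [hlast])
      simp at this
  | succ h ih =>
    set N : Ideal R := ⨅ Q : {Q : Ideal R // Q.IsPrime ∧ I ≤ Q ∧ Q ≤ P.asIdeal},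
      Q.1.colon {x 0} with hN
    have memN : ∀ a, a ∈ N ↔ ∀ Q : Ideal R, Q.IsPrime → I ≤ Q → Q ≤ P.asIdeal →
        a * x 0 ∈ Q := fun a => by
      simp [hN, Submodule.mem_colon_singleton]
    by_cases hNP : N ≤ P.asIdeal
    · set I' := I ⊔ Ideal.span {x 0} ⊔ N with hI'
      have hx0 : x 0 ∈ I' :=
        le_sup_left (a := I ⊔ Ideal.span {x 0})
          (le_sup_right (a := I) (Ideal.mem_span_singleton_self _))
      have hII' : I ≤ I' := le_sup_left.trans le_sup_left
      have hI'P : I' ≤ P.asIdeal := sup_le (sup_le hI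
        ((Ideal.span_singleton_le_iff_mem _).mpr (hx 0))) hNP
      obtain ⟨a, ha⟩ := ih I' hI'P (fun l hl1 hl2 => by
        have hlt : ∃ Q : PrimeSpectrum R, I ≤ Q.asIdeal ∧ Q < l.head := by
          by_contra! hno
          obtain ⟨s, hs, n, hn⟩ := Ideal.exists_mul_pow_mem_of_forall_prime
            (I := I) (P := l.head.asIdeal) (z := x 0) fun Q hQ hIQ hQl => by
              have : (⟨Q, hQ⟩ : PrimeSpectrum R) = l.head :=
                (show (⟨Q, hQ⟩ : PrimeSpectrum R) ≤ l.head from hQl).eq_of_not_lt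
                  (hno ⟨Q, hQ⟩ hIQ)
              rw [← this] at hl1
              exact hl1 hx0
          refine hs (hl1 ((le_sup_right : N ≤ I') ((memN s).mpr fun Q hQ hIQ _ => ?_)))
          rcases hQ.mem_or_mem (hIQ hn) with h1 | h1
          · exact Q.mul_mem_right _ h1
          · exact Q.mul_mem_left _ (hQ.mem_of_pow_mem _ h1)
        obtain ⟨Q, hIQ, hQl⟩ := hlt
        have := hl (l.cons Q hQl) (by simpa using hIQ) (by simpa using hl2)
        simpa using this) (fun i => x i.succ) fun i => hx _
      obtain ⟨s, hs, n, hn⟩ := Ideal.exists_mul_pow_mem_of_forall_prime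
        (I := I' ⊔ Ideal.span (Set.range fun i => x (Fin.succ i) + z * a i))
        (P := P.asIdeal) (z := z) fun Q hQ hIQ hQP =>
          ha Q hQ (le_sup_left.trans hIQ) hQP fun i =>
            hIQ ((le_sup_right : _ ≤ I' ⊔ _) (Ideal.subset_span ⟨i, rfl⟩))
      obtain ⟨u, hu, v, hv, huv⟩ := Submodule.mem_sup.mp hn
      obtain ⟨w, hw, b, hb, rfl⟩ := Submodule.mem_sup.mp hu
      refine ⟨Fin.cons b a, fun Q hQ hIQ hQP hQx => ?_⟩
      have hQ0 : x 0 + z * b ∈ Q := by simpa using hQx 0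
      have hQs : ∀ i : Fin h, x i.succ + z * a i ∈ Q := fun i => by simpa using hQx i.succ
      have hbx := (memN b).mp hb Q hQ hIQ hQP
      by_cases hbQ : b ∈ Q
      · have hx0Q : x 0 ∈ Q := (Q.add_mem_iff_left (Q.mul_mem_left z hbQ)).mp hQ0
        have hwQ : w ∈ Q :=
          (sup_le hIQ ((Ideal.span_singleton_le_iff_mem _).mpr hx0Q) : I ⊔ _ ≤ Q) hw
        have hvQ : v ∈ Q := (Ideal.span_le.mpr (by rintro _ ⟨i, rfl⟩; exact hQs i)) hv
        have : s * z ^ n ∈ Q := huv ▸ Q.add_mem (Q.add_mem hwQ hbQ) hvQ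
        exact hQ.mem_of_pow_mem _ ((hQ.mem_or_mem this).resolve_left fun h => hs (hQP h))
      · have hx0Q := (hQ.mem_or_mem hbx).resolve_left hbQ
        exact (hQ.mem_or_mem ((Q.add_mem_iff_right hx0Q).mp hQ0)).resolve_right hbQ
    · obtain ⟨b, hbN, hbP⟩ := SetLike.not_le_iff_exists.mp hNP
      refine ⟨Fin.cons b 0, fun Q hQ hIQ hQP hQx => ?_⟩
      have hbQ : b ∉ Q := fun h => hbP (hQP h)
      have hQ0 : x 0 + z * b ∈ Q := by simpa using hQx 0
      have hx0Q := (hQ.mem_or_mem ((memN b).mp hbN Q hQ hIQ hQP)).resolve_left hbQ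
      exact (hQ.mem_or_mem ((Q.add_mem_iff_right hx0Q).mp hQ0)).resolve_right hbQ

/-- **Local Kronecker theorem**: up to radical, every finitely generated ideal inside a prime of
height `h` is, locally at that prime, generated by `h` elements. -/
theorem exists_radical_generators {P : PrimeSpectrum R} {h : ℕ} (hP : Order.height P ≤ h)
    {n : ℕ} (x : Fin n → R) (hx : ∀ i, x i ∈ P.asIdeal) :
    ∃ y : Fin h → R, (∀ i, y i ∈ P.asIdeal) ∧ ∀ Q : Ideal R, Q.IsPrime → Q ≤ P.asIdeal →
      (∀ i, y i ∈ Q) → ∀ i, x i ∈ Q := by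
  induction n with
  | zero => exact ⟨0, by simp, fun _ _ _ _ i => i.elim0⟩
  | succ n ih =>
    obtain ⟨y, hyP, hy⟩ := ih (fun i => x i.succ) fun i => hx _
    obtain ⟨a, ha⟩ := exists_absorb P h ⊥ bot_le
      (fun l _ hl => by exact_mod_cast (Order.length_le_height hl).trans hP) y hyP (hx 0)
    refine ⟨fun i => y i + x 0 * a i,
      fun i => P.asIdeal.add_mem (hyP i) (P.asIdeal.mul_mem_right _ (hx 0)),
      fun Q hQ hQP hQy => ?_⟩
    have h0 := ha Q hQ bot_le hQP hQy
    exact Fin.cases h0 (hy Q hQ hQP fun i =>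
      (Q.add_mem_iff_left (Q.mul_mem_right _ h0)).mp (hQy i))

end LocalKronecker

section KoszulGrade

open Finset

variable {A : Type*} [CommRing A] {M : Type*} [AddCommGroup M] [Module A M]

lemma koszulMap_apply_eq_koszulDiff {n : ℕ} (x : Fin n → A) (i : ℕ) (g : Finset (Fin n) → M)
    (t : {s : Finset (Fin n) // #s = i + 1}) :
    koszulMap A M x i (fun u => g u.1) t = koszulDiff x g t.1 :=
  sum_attach t.1 fun j => (koszulSign A j t.1 * x j) • g (t.1.erase j)

lemma exists_extend_card {n i : ℕ} (g : {s : Finset (Fin n) // #s = i} → M) :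
    ∃ g' : Finset (Fin n) → M, g = fun u => g' u.1 :=
  ⟨Function.extend Subtype.val g 0,
    funext fun u => (Subtype.val_injective.extend_apply g 0 u).symm⟩

lemma koszulCohomologyNeZero_iff {n : ℕ} (x : Fin n → A) (i : ℕ) :
    koszulCohomologyNeZero A M x i ↔ ¬ KoszulVanish ⊥ M x univ i := by
  have hker : ∀ (j : ℕ) (g : Finset (Fin n) → M),
      (fun u => g u.1) ∈ LinearMap.ker (koszulMap A M x j) ↔
        ∀ t ⊆ univ, #t = j + 1 → koszulDiff x g t = 0 := fun j g => by
    rw [LinearMap.mem_ker, funext_iff]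
    simp [koszulMap_apply_eq_koszulDiff]
  cases i with
  | zero =>
    rw [koszulCohomologyNeZero, ne_eq, not_iff_not]
    constructor
    · intro H g hg
      refine ⟨1, Submonoid.one_mem _, 0, fun t _ ht => ?_⟩
      have h0 := (hker 0 g).mpr hg
      rw [H, Submodule.mem_bot] at h0
      simpa using congrFun h0 ⟨t, ht⟩
    · intro H
      rw [eq_bot_iff]
      intro g hg
      obtain ⟨g, rfl⟩ := exists_extend_card g
      obtain ⟨s, hs, h, hh⟩ := H g ((hker 0 g).mp hg)
      obtain rfl := Submonoid.mem_bot.mp hs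
      rw [Submodule.mem_bot]
      funext t
      have := hh t.1 (subset_univ _) t.2
      rw [one_smul, card_eq_zero.mp t.2, koszulDiff_apply, sum_empty] at this
      simpa [card_eq_zero.mp t.2] using this
  | succ i =>
    rw [koszulCohomologyNeZero, not_iff_not]
    constructor
    · intro H g hg
      obtain ⟨h, hh⟩ := H ((hker _ g).mpr hg)
      obtain ⟨h, rfl⟩ := exists_extend_card h
      refine ⟨1, Submonoid.one_mem _, h, fun t _ ht => ?_⟩
      rw [one_smul, ← koszulMap_apply_eq_koszulDiff x i h ⟨t, ht⟩, hh]
    · intro H g hg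
      obtain ⟨g, rfl⟩ := exists_extend_card g
      obtain ⟨s, hs, h, hh⟩ := H g ((hker _ g).mp hg)
      obtain rfl := Submonoid.mem_bot.mp hs
      refine ⟨fun u => h u.1, funext fun t => ?_⟩
      rw [koszulMap_apply_eq_koszulDiff, ← hh t.1 (subset_univ _) t.2, one_smul]

lemma le_kgrSeq_iff {n : ℕ} (x : Fin n → A) (r : ℕ) :
    (r : ℕ∞) ≤ kgrSeq A M x ↔ ∀ i < r, KoszulVanish ⊥ M x univ i := by
  rw [kgrSeq, le_sInf_iff]
  constructor
  · intro H i hi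
    by_contra hV
    exact absurd (H i ⟨i, rfl, (koszulCohomologyNeZero_iff x i).mpr hV⟩)
      (not_le.mpr (by exact_mod_cast hi))
  · rintro H _ ⟨i, rfl, hi⟩
    by_contra! hlt
    exact (koszulCohomologyNeZero_iff x i).mp hi (H i (by exact_mod_cast hlt))

lemma le_kgr_iff (𝔞 : Ideal A) (r : ℕ) :
    (r : ℕ∞) ≤ kgr A 𝔞 M ↔
      ∃ (n : ℕ) (x : Fin n → A), (∀ j, x j ∈ 𝔞) ∧ ∀ i < r, KoszulVanish ⊥ M x univ i := by
  constructor
  · intro H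
    cases r with
    | zero => exact ⟨0, 0, fun j => j.elim0, by simp⟩
    | succ r =>
      have H' : (r : ℕ∞) < kgr A 𝔞 M := lt_of_lt_of_le (by exact_mod_cast r.lt_succ_self) H
      simp only [kgr, lt_iSup_iff] at H'
      obtain ⟨n, x, hx, hr⟩ := H'
      refine ⟨n, x, hx, (le_kgrSeq_iff x _).mp ?_⟩
      exact_mod_cast Order.add_one_le_of_lt hr
  · rintro ⟨n, x, hx, H⟩
    exact ((le_kgrSeq_iff x r).mpr H).trans
      (le_iSup_of_le n (le_iSup_of_le x (le_iSup_of_le hx le_rfl)))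

lemma koszulVanish_castAdd_iff {S : Submonoid A} {n m i : ℕ} (x : Fin n → A) (y : Fin m → A) :
    KoszulVanish S M (Fin.append x y) (univ.map (Fin.castAddOrderEmb m).toEmbedding) i ↔
      KoszulVanish S M x univ i := by
  rw [koszulVanish_map_iff]
  exact iff_of_eq (congrArg (KoszulVanish S M · univ i) (funext fun j => Fin.append_left x y j))

lemma koszulVanish_natAdd_iff {S : Submonoid A} {n m i : ℕ} (x : Fin n → A) (y : Fin m → A) :
    KoszulVanish S M (Fin.append x y) (univ.map (Fin.natAddOrderEmb n).toEmbedding) i ↔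
      KoszulVanish S M y univ i := by
  rw [koszulVanish_map_iff]
  exact iff_of_eq (congrArg (KoszulVanish S M · univ i) (funext fun j => Fin.append_right x y j))

lemma KoszulVanish.append_left {S : Submonoid A} {n m r : ℕ} {x : Fin n → A} (y : Fin m → A)
    (H : ∀ i < r, KoszulVanish S M x univ i) :
    ∀ i < r, KoszulVanish S M (Fin.append x y) univ i :=
  KoszulVanish.mono (subset_univ _) fun i hi => (koszulVanish_castAdd_iff x y).mpr (H i hi)

lemma KoszulVanish.append_right {S : Submonoid A} {n m r : ℕ} (x : Fin n → A) {y : Fin m → A}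
    (H : ∀ i < r, KoszulVanish S M y univ i) :
    ∀ i < r, KoszulVanish S M (Fin.append x y) univ i :=
  KoszulVanish.mono (subset_univ _) fun i hi => (koszulVanish_natAdd_iff x y).mpr (H i hi)

lemma KoszulVanish.of_bot {ι : Type*} [LinearOrder ι] {x : ι → A} {T : Finset ι} {i : ℕ}
    (S : Submonoid A) (H : KoszulVanish ⊥ M x T i) : KoszulVanish S M x T i := fun g hg =>
  let ⟨s, hs, h⟩ := H g hg
  ⟨s, (bot_le : ⊥ ≤ S) hs, h⟩

/-- The Koszul grade of a sequence inside a prime is at most the height of the prime. -/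
theorem kgrSeq_le_height (P : PrimeSpectrum A) {n : ℕ} (x : Fin n → A)
    (hx : ∀ j, x j ∈ P.asIdeal) : kgrSeq A A x ≤ Order.height P := by
  by_contra! hlt
  obtain ⟨h, hh⟩ := ENat.ne_top_iff_exists.mp hlt.ne_top
  obtain ⟨y, hyP, hy⟩ := exists_radical_generators hh.ge x hx
  have hV := (le_kgrSeq_iff (M := A) x (h + 1)).mp
    (by rw [← hh] at hlt; exact_mod_cast Order.add_one_le_of_lt hlt)
  have hV' := (KoszulVanish.append_left y hV h h.lt_succ_self).of_bot P.asIdeal.primeCompl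
  have hrange : Fin.append x y '' (univ.map (Fin.natAddOrderEmb n).toEmbedding :
      Finset (Fin (n + h))) =
      Set.range y := by
    rw [coe_map, coe_univ, Set.image_univ, ← Set.range_comp]
    exact congrArg Set.range (funext fun j => Fin.append_right x y j)
  have hVy : KoszulVanish P.asIdeal.primeCompl A (Fin.append x y)
      (univ.map (Fin.natAddOrderEmb n).toEmbedding) h := by
    refine hV'.of_subset (subset_univ _) fun p _ => ?_
    rw [hrange]
    refine Ideal.exists_mul_pow_mem_of_forall_prime fun Q hQ hIQ hQP => ?_
    have hyQ : ∀ i, y i ∈ Q := fun i => hIQ (Ideal.subset_span ⟨i, rfl⟩)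
    refine Fin.addCases (fun j => ?_) (fun j => ?_) p
    · rw [Fin.append_left]
      exact hy Q hQ hQP hyQ j
    · rw [Fin.append_right]
      exact hyQ j
  rw [koszulVanish_natAdd_iff] at hVy
  obtain ⟨s, hs, hsy⟩ := KoszulVanish.exists_mem_span (T := univ) (x := y) (by simpa using hVy)
  refine hs (Ideal.span_le.mpr ?_ hsy)
  rintro _ ⟨j, -, rfl⟩
  exact hyP j

/-- The Koszul grade of an ideal on the ring is at most its height. -/
theorem kgr_le_idealHeight (𝔞 : Ideal A) : kgr A 𝔞 A ≤ idealHeight A 𝔞 :=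
  le_iInf₂ fun P hP => iSup_le fun _ => iSup_le fun x => iSup_le fun hx =>
    kgrSeq_le_height P x fun j => hP (hx j)

end KoszulGrade

section Height

variable {A R : Type*} [CommRing A] [CommRing R]

lemma idealHeight_mono {𝔞 𝔟 : Ideal A} (h : 𝔞 ≤ 𝔟) : idealHeight A 𝔞 ≤ idealHeight A 𝔟 :=
  le_iInf₂ fun P hP => iInf₂_le P (h.trans hP)

lemma idealHeight_le_comap (φ : A →+* R)
    (H : ∀ P : Ideal R, P.IsPrime → idealHeight R P ≤ idealHeight A (P.comap φ)) (I : Ideal R) :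
    idealHeight R I ≤ idealHeight A (I.comap φ) := by
  refine le_iInf₂ fun p hp => ?_
  obtain ⟨q, hq, hqp⟩ := Ideal.exists_minimalPrimes_le hp
  obtain ⟨P, hP, hIP, rfl⟩ := Ideal.exists_comap_eq_of_mem_minimalPrimes φ q hq
  calc idealHeight R I ≤ idealHeight R P := idealHeight_mono hIP
    _ ≤ idealHeight A (P.comap φ) := H P hP
    _ ≤ Order.height p := iInf₂_le p hqp

end Height

section Amalgamation

open Finset

variable {A B : Type*} [CommRing A] [CommRing B] (f : A →+* B) (J : Ideal B)

/-- The additive projection of `A ⋈^f J` to `A`. -/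
def amalgFst : amalgamation f J →+ A :=
  (AddMonoidHom.fst A B).comp (amalgamation f J).subtype.toAddMonoidHom

/-- The additive projection `(a, f a + j) ↦ j` of `A ⋈^f J` to `J`. -/
def amalgDiff : amalgamation f J →+ J where
  toFun z := ⟨z.1.2 - f z.1.1, z.2⟩
  map_zero' := Subtype.ext (by simp)
  map_add' z w := Subtype.ext (by simp [add_sub_add_comm])

/-- The additive embedding `j ↦ (0, j)` of `J` into `A ⋈^f J`. -/
def amalgInr : J →+ amalgamation f J where
  toFun j := ⟨(0, j), show (j : B) - f 0 ∈ J by simp⟩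
  map_zero' := Subtype.ext (by simp)
  map_add' z w := Subtype.ext (by simp)

lemma amalgIota_amalgFst_add (z : amalgamation f J) :
    amalgIota f J (amalgFst f J z) + amalgInr f J (amalgDiff f J z) = z :=
  Subtype.ext (Prod.ext (by simp [amalgIota, amalgFst, amalgInr])
    (by simp [amalgIota, amalgFst, amalgInr, amalgDiff]))

/-- Koszul vanishing on `A ⋈^f J` follows from vanishing on its summands `A` and `J`. -/
lemma koszulVanish_amalgamation {n i : ℕ} (x : Fin n → A) (HA : KoszulVanish ⊥ A x univ i)
    (HJ : letI : Module A J := Module.compHom J f; KoszulVanish ⊥ J x univ i) :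
    KoszulVanish ⊥ (amalgamation f J) (amalgIota f J ∘ x) univ i := by
  let : Module A J := Module.compHom J f
  have smulJ : ∀ (a : A) (j : J), ((a • j : J) : B) = f a * j := fun _ _ => rfl
  have hfst : ∀ j m, amalgFst f J ((amalgIota f J ∘ x) j • m) = x j • amalgFst f J m :=
    fun _ _ => rfl
  have hdiff : ∀ j m, amalgDiff f J ((amalgIota f J ∘ x) j • m) = x j • amalgDiff f J m :=
    fun j m => Subtype.ext (by simp [amalgDiff, amalgIota, smulJ, mul_sub])
  have hiota : ∀ j m, (amalgIota f J).toAddMonoidHom (x j • m) =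
      (amalgIota f J ∘ x) j • (amalgIota f J).toAddMonoidHom m :=
    fun j m => map_mul (amalgIota f J) (x j) m
  have hinr : ∀ j m, amalgInr f J (x j • m) = (amalgIota f J ∘ x) j • amalgInr f J m :=
    fun j m => Subtype.ext (by simp [amalgInr, amalgIota, smulJ])
  intro g hg
  obtain ⟨s, hs, a, ha⟩ := HA (fun t => amalgFst f J (g t)) fun t ht hti => by
    rw [← map_koszulDiff _ hfst, hg t ht hti, map_zero]
  obtain ⟨s', hs', b, hb⟩ := HJ (fun t => amalgDiff f J (g t)) fun t ht hti => by
    rw [← map_koszulDiff _ hdiff, hg t ht hti, map_zero]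
  obtain rfl := Submonoid.mem_bot.mp hs
  obtain rfl := Submonoid.mem_bot.mp hs'
  refine ⟨1, Submonoid.one_mem _, (fun t => (amalgIota f J).toAddMonoidHom (a t)) +
    fun t => amalgInr f J (b t), fun t ht hti => ?_⟩
  rw [map_add, Pi.add_apply, ← map_koszulDiff _ hiota, ← map_koszulDiff _ hinr,
    ← ha t ht hti, ← hb t ht hti, one_smul, one_smul, one_smul]
  exact (amalgIota_amalgFst_add f J (g t)).symm

lemma le_kgr_amalgamation (I : Ideal (amalgamation f J)) {r : ℕ}
    (hA : (r : ℕ∞) ≤ kgr A (I.comap (amalgIota f J)) A)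
    (hJ : (r : ℕ∞) ≤ kgrIdeal f J (I.comap (amalgIota f J))) :
    (r : ℕ∞) ≤ kgr (amalgamation f J) I (amalgamation f J) := by
  let : Module A J := Module.compHom J f
  obtain ⟨n, x, hx, hVx⟩ := (le_kgr_iff _ r).mp hA
  obtain ⟨m, y, hy, hVy⟩ := (le_kgr_iff (M := J) _ r).mp hJ
  refine (le_kgr_iff _ r).mpr ⟨n + m, amalgIota f J ∘ Fin.append x y, fun j => ?_, fun i hi =>
    koszulVanish_amalgamation f J _ (KoszulVanish.append_left y hVx i hi)
      (KoszulVanish.append_right x hVy i hi)⟩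
  refine Fin.addCases (fun j => ?_) (fun j => ?_) j
  · simpa using hx j
  · simpa using hy j

end Amalgamation

/-- Assume `height 𝒫 ≤ height 𝒫^c` for every prime `𝒫` of `A⋈^f J`.
If `A` is Cohen-Macaulay in the sense of ideals and `kgr_A(𝔞, J) ≥ height 𝔞` for every
ideal `𝔞` of `A`, then `A⋈^f J` is Cohen-Macaulay in the sense of ideals. -/
theorem isCMIdeals_amalgamation_of_height_le {A B : Type*} [CommRing A] [CommRing B]
    (f : A →+* B) (J : Ideal B)
    (hht : ∀ P : Ideal ↥(amalgamation f J), P.IsPrime →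
      idealHeight ↥(amalgamation f J) P ≤ idealHeight A (P.comap (amalgIota f J)))
    (hA : IsCMIdeals A)
    (hJ : ∀ 𝔞 : Ideal A, idealHeight A 𝔞 ≤ kgrIdeal f J 𝔞) :
    IsCMIdeals ↥(amalgamation f J) := by
  intro I
  refine le_antisymm (ENat.forall_natCast_le_iff_le.mp fun r hr => ?_) (kgr_le_idealHeight I)
  have hr' := hr.trans (idealHeight_le_comap (amalgIota f J) hht I)
  exact le_kgr_amalgamation f J I (hr'.trans (hA _).le) (hr'.trans (hJ _))
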